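/- arXiv:1203.2576 — 2 statements merged into one kernel-verified Lean document; each statement's English description precedes it below -/
import Mathlib

section
/- For every nonzero rational number u, there exists a rational number y such that the point with x-coordinate x3(u) = (1 + 4u^2 + 6u^4 + 3u^6 - 4u^8 + 2u^10)^2 / (4u^2) and y-coordinate y lies on the elliptic curve y^2 = x^3 - N(u) x over the rationals, where N(u) = (1 + 6 u^2 + u^4)(1 - u^4 + u^8)(1 - 4 u^2 + 8 u^4 - 4 u^6 + u^8)(1 + 2 u^2 + 11 u^4 + 2 u^6 + u^8). -/
/-- There is a rational point on the curve `y² = x³ - N(u)x` with `x`-coordinate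
`x₃(u) = (1 + 4u² + 6u⁴ + 3u⁶ - 4u⁸ + 2u¹⁰)² / (4u²)`, where `N(u)` is Euler's family. -/
theorem point_x3u_on_curve (u : ℚ) (hu : u ≠ 0) :
    ∃ y : ℚ,
      y^2 = ((1 + 4 * u^2 + 6 * u^4 + 3 * u^6 - 4 * u^8 + 2 * u^10)^2 / (4 * u^2))^3 -
        ((1 + 6 * u^2 + u^4) * (1 - u^4 + u^8) * (1 - 4 * u^2 + 8 * u^4 - 4 * u^6 + u^8) *
            (1 + 2 * u^2 + 11 * u^4 + 2 * u^6 + u^8)) *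
          ((1 + 4 * u^2 + 6 * u^4 + 3 * u^6 - 4 * u^8 + 2 * u^10)^2 / (4 * u^2)) := by
  refine ⟨(1 + 4 * u^2 + 6 * u^4 + 3 * u^6 - 4 * u^8 + 2 * u^10) *
    (1 + 8 * u^2 + 20 * u^4 + 86 * u^6 - 4 * u^8 + 8 * u^10 + 25 * u^12 - 28 * u^16 + 16 * u^18 - 4 * u^20) /
      (8 * u^3), ?_⟩
  field_simp
  ring
end

section
/- For every rational number u with 1 + u + 4u^2 - 2u^3 - 2u^4 - 2u^5 + u^6 + u^7 ≠ 0, there exists a rational number y such that the point with x-coordinate x4(u) = (1 + u + 6u^2 + 5u^3 + 5u^4 - 21u^5 - 5u^6 - 2u^7 + 13u^8 + 15u^9 - u^10 - 7u^11 + u^13 + u^14)^2 / (1 + u + 4u^2 - 2u^3 - 2u^4 - 2u^5 + u^6 + u^7)^2 and y-coordinate y lies on the elliptic curve y^2 = x^3 - N(u) x over the rationals, where N(u) = (1 + 6 u^2 + u^4)(1 - u^4 + u^8)(1 - 4 u^2 + 8 u^4 - 4 u^6 + u^8)(1 + 2 u^2 + 11 u^4 + 2 u^6 + u^8). -/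
/-- The quantity `A⁴ - N(u)B⁴` is a perfect square, where `x₄(u) = (A / B)²`. -/
theorem x4_fourth_power_sub_eq_sq {R : Type*} [CommRing R] (u : R) :
    (1 + u + 6 * u^2 + 5 * u^3 + 5 * u^4 - 21 * u^5 - 5 * u^6 - 2 * u^7 + 13 * u^8 +
        15 * u^9 - u^10 - 7 * u^11 + u^13 + u^14)^4 -
      ((1 + 6 * u^2 + u^4) * (1 - u^4 + u^8) * (1 - 4 * u^2 + 8 * u^4 - 4 * u^6 + u^8) *
        (1 + 2 * u^2 + 11 * u^4 + 2 * u^6 + u^8)) *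
      (1 + u + 4 * u^2 - 2 * u^3 - 2 * u^4 - 2 * u^5 + u^6 + u^7)^4 =
    (u * (2 + 9 * u + 22 * u^2 + 57 * u^3 + 28 * u^4 + 3 * u^5 - 216 * u^6 -
        129 * u^7 - 228 * u^8 + 201 * u^9 + 484 * u^10 + 363 * u^11 - 468 * u^12 - 516 * u^13 -
        216 * u^14 + 435 * u^15 + 484 * u^16 - 159 * u^17 - 264 * u^18 - 129 * u^19 + 36 * u^20 +
        75 * u^21 + 28 * u^22 - 15 * u^23 - 14 * u^24 - 3 * u^25 + 2 * u^26))^2 := by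
  ring

/-- If `a⁴ - N b⁴ = c²`, then `(a² / b², ac / b³)` lies on `y² = x³ - N x`. -/
theorem exists_sq_eq_cube_sub_mul {K : Type*} [Field K] {a b c N : K} (hb : b ≠ 0)
    (h : a^4 - N * b^4 = c^2) :
    ∃ y : K, y^2 = (a^2 / b^2)^3 - N * (a^2 / b^2) := by
  refine ⟨a * c / b^3, ?_⟩
  rw [div_pow, mul_pow, ← h]
  field_simp

/-- There is a rational point on the curve `y² = x³ - N(u)x` with `x`-coordinate
`x₄(u)`, where `N(u)` is Euler's family. -/
theorem point_x4u_on_curve (u : ℚ)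
    (hu : 1 + u + 4 * u^2 - 2 * u^3 - 2 * u^4 - 2 * u^5 + u^6 + u^7 ≠ 0) :
    ∃ y : ℚ,
      y^2 = ((1 + u + 6 * u^2 + 5 * u^3 + 5 * u^4 - 21 * u^5 - 5 * u^6 - 2 * u^7 + 13 * u^8 +
              15 * u^9 - u^10 - 7 * u^11 + u^13 + u^14)^2 /
            (1 + u + 4 * u^2 - 2 * u^3 - 2 * u^4 - 2 * u^5 + u^6 + u^7)^2)^3 -
        ((1 + 6 * u^2 + u^4) * (1 - u^4 + u^8) * (1 - 4 * u^2 + 8 * u^4 - 4 * u^6 + u^8) *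
            (1 + 2 * u^2 + 11 * u^4 + 2 * u^6 + u^8)) *
          ((1 + u + 6 * u^2 + 5 * u^3 + 5 * u^4 - 21 * u^5 - 5 * u^6 - 2 * u^7 + 13 * u^8 +
              15 * u^9 - u^10 - 7 * u^11 + u^13 + u^14)^2 /
            (1 + u + 4 * u^2 - 2 * u^3 - 2 * u^4 - 2 * u^5 + u^6 + u^7)^2) := by
  exact exists_sq_eq_cube_sub_mul hu (x4_fourth_power_sub_eq_sq u)
end
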